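/- arXiv:2401.12105 — 2 statements merged into one kernel-verified Lean document; each statement's English description precedes it below -/
import Mathlib

section
/- Convexity of coherent information in the channel: if Λ = Σ_i p_i Λ_i is a convex combination of quantum channels on system A, then for any state ρ_A with purification |Ψ⟩_{RA}, S(Λ(ρ)) − S((I_R⊗Λ)(|Ψ⟩⟨Ψ|)) ≤ Σ_i p_i [S(Λ_i(ρ)) − S((I_R⊗Λ_i)(|Ψ⟩⟨Ψ|))]. -/
open Matrix Kronecker BigOperators
open scoped ComplexOrder

noncomputable def ptrB {α β : Type*} [Fintype β] (M : Matrix (α × β) (α × β) ℂ) :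
    Matrix α α ℂ := Matrix.of fun i j => ∑ b, M (i, b) (j, b)

noncomputable def ptrA {α β : Type*} [Fintype α] (M : Matrix (α × β) (α × β) ℂ) :
    Matrix β β ℂ := Matrix.of fun i j => ∑ a, M (a, i) (a, j)

def IsDensity {n : Type*} [Fintype n] (ρ : Matrix n n ℂ) : Prop :=
  ρ.PosSemidef ∧ ρ.trace = 1

noncomputable def vnEntropy {n : Type*} [Fintype n] [DecidableEq n]
    (ρ : Matrix n n ℂ) : ℝ :=
  if h : ρ.IsHermitian then -∑ i, (h.eigenvalues i) * Real.logb 2 (h.eigenvalues i) else 0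

def idTensor {R A B : Type*} (Λ : Matrix A A ℂ → Matrix B B ℂ)
    (M : Matrix (R × A) (R × A) ℂ) : Matrix (R × B) (R × B) ℂ :=
  Matrix.of fun x y => Λ (Matrix.of fun a a' => M (x.1, a) (y.1, a')) x.2 y.2

def IsCPTP {A B : Type*} [Fintype A] [Fintype B]
    (Λ : Matrix A A ℂ → Matrix B B ℂ) : Prop :=
  (∀ M N, Λ (M + N) = Λ M + Λ N) ∧ (∀ (c : ℂ) M, Λ (c • M) = c • Λ M) ∧
  (∀ M, (Λ M).trace = M.trace) ∧
  (∀ (n : ℕ) (M : Matrix (Fin n × A) (Fin n × A) ℂ), M.PosSemidef →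
    (idTensor Λ M).PosSemidef)

/-- Spectral decompositions of two positive semidefinite matrices such that the support of the
left one is contained in the support of the right one. -/
structure SpectralPair (n : Type*) [Fintype n] [DecidableEq n] where
  U : Matrix.unitaryGroup n ℂ
  V : Matrix.unitaryGroup n ℂ
  r : n → ℝ
  s : n → ℝ
  r_nonneg : ∀ i, 0 ≤ r i
  s_nonneg : ∀ j, 0 ≤ s j
  support : ∀ j i, s j = 0 → (star (V : Matrix n n ℂ) * (U : Matrix n n ℂ)) j i = 0 ∨ r i = 0

namespace SpectralPair

variable {n : Type*} [Fintype n] [DecidableEq n] (P : SpectralPair n)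

/-- The unitary matrix of overlaps between the two eigenbases. -/
def overlap : Matrix n n ℂ := star (P.V : Matrix n n ℂ) * (P.U : Matrix n n ℂ)

noncomputable def left : Matrix n n ℂ :=
  (P.U : Matrix n n ℂ) * diagonal (fun i => (P.r i : ℂ)) * star (P.U : Matrix n n ℂ)

noncomputable def right : Matrix n n ℂ :=
  (P.V : Matrix n n ℂ) * diagonal (fun i => (P.s i : ℂ)) * star (P.V : Matrix n n ℂ)

/-- The relative entropy of the two matrices, in nats. -/
noncomputable def relEntropy : ℝ :=
  ∑ j, ∑ i, ‖P.overlap j i‖ ^ 2 * (P.r i * (Real.log (P.r i) - Real.log (P.s j)))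

/-- An antiderivative of `resolventForm`. -/
noncomputable def logForm (t : ℝ) : ℝ :=
  ∑ j, ∑ i, ‖P.overlap j i‖ ^ 2 * (P.r i * Real.log (P.s j + t * P.r i))

/-- The quadratic form `⟨ρ, (L_σ + t R_ρ)⁻¹ ρ⟩`, where `L` and `R` are left and right
multiplication. -/
noncomputable def resolventForm (t : ℝ) : ℝ :=
  ∑ j, ∑ i, ‖P.overlap j i‖ ^ 2 * (P.r i * (P.r i / (P.s j + t * P.r i)))

end SpectralPair

/-- The functional whose supremum over `Y` is `⟨ρ, (L_σ + t R_ρ)⁻¹ ρ⟩`. -/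
noncomputable def variationalForm {n : Type*} [Fintype n] (t : ℝ) (ρ σ Y : Matrix n n ℂ) : ℝ :=
  2 * (trace (star Y * ρ)).re - (trace (star Y * σ * Y)).re - t * (trace (Y * ρ * star Y)).re

theorem variationalForm_sum {n κ : Type*} [Fintype n] [Fintype κ] (t : ℝ) (p : κ → ℝ)
    (ρ σ : κ → Matrix n n ℂ) (Y : Matrix n n ℂ) :
    variationalForm t (∑ k, (p k : ℂ) • ρ k) (∑ k, (p k : ℂ) • σ k) Y =
      ∑ k, p k * variationalForm t (ρ k) (σ k) Y := by
  simp only [variationalForm, Finset.mul_sum, Finset.sum_mul, trace_sum, mul_smul_comm,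
    smul_mul_assoc, trace_smul, Complex.re_sum, smul_eq_mul, Complex.re_ofReal_mul,
    ← Finset.sum_sub_distrib]
  exact Finset.sum_congr rfl fun k _ => by ring

namespace SpectralPair

variable {n : Type*} [Fintype n] [DecidableEq n] (P : SpectralPair n)

theorem variationalForm_conj (t : ℝ) (Z : Matrix n n ℂ) :
    variationalForm t P.left P.right ((P.V : Matrix n n ℂ) * Z * star (P.U : Matrix n n ℂ)) =
      ∑ j, ∑ i, (2 * (P.r i * (star (Z j i) * P.overlap j i).re) -
        (P.s j + t * P.r i) * ‖Z j i‖ ^ 2) := by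
  have hU : star (P.U : Matrix n n ℂ) * P.U = 1 := Unitary.coe_star_mul_self P.U
  have hV : star (P.V : Matrix n n ℂ) * P.V = 1 := Unitary.coe_star_mul_self P.V
  set r : Matrix n n ℂ := diagonal fun i => (P.r i : ℂ) with hr
  set s : Matrix n n ℂ := diagonal fun i => (P.s i : ℂ) with hs
  have h1 : trace (star ((P.V : Matrix n n ℂ) * Z * star (P.U : Matrix n n ℂ)) * P.left) =
      trace (star Z * P.overlap * r) := by
    rw [left, overlap, star_mul, star_mul, star_star, trace_mul_comm]
    calc _ = trace ((P.U : Matrix n n ℂ) * (r * (star (P.U : Matrix n n ℂ) * (P.U : Matrix n n ℂ)) * star Z *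
            star (P.V : Matrix n n ℂ))) := by simp only [Matrix.mul_assoc]; rfl
      _ = trace (r * (star Z * (star (P.V : Matrix n n ℂ) * (P.U : Matrix n n ℂ)))) := by
        rw [trace_mul_comm, hU]; simp only [Matrix.mul_assoc, Matrix.one_mul]
      _ = _ := trace_mul_comm _ _
  have h2 : trace (star ((P.V : Matrix n n ℂ) * Z * star (P.U : Matrix n n ℂ)) * P.right *
      ((P.V : Matrix n n ℂ) * Z * star (P.U : Matrix n n ℂ))) = trace (star Z * s * Z) := by
    rw [right, star_mul, star_mul, star_star]
    calc _ = trace ((P.U : Matrix n n ℂ) * (star Z * (star (P.V : Matrix n n ℂ) * (P.V : Matrix n n ℂ)) * s *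
            (star (P.V : Matrix n n ℂ) * (P.V : Matrix n n ℂ)) * Z * star (P.U : Matrix n n ℂ))) := by
          simp only [Matrix.mul_assoc]; rfl
      _ = _ := by
        rw [trace_mul_comm, Matrix.mul_assoc _ _ (P.U : Matrix n n ℂ), hU, hV]
        simp only [Matrix.mul_one]
  have h3 : trace ((P.V : Matrix n n ℂ) * Z * star (P.U : Matrix n n ℂ) * P.left *
      star ((P.V : Matrix n n ℂ) * Z * star (P.U : Matrix n n ℂ))) = trace (Z * r * star Z) := by
    rw [left, star_mul, star_mul, star_star]
    calc _ = trace ((P.V : Matrix n n ℂ) * (Z * (star (P.U : Matrix n n ℂ) * (P.U : Matrix n n ℂ)) * r *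
            (star (P.U : Matrix n n ℂ) * (P.U : Matrix n n ℂ)) * star Z * star (P.V : Matrix n n ℂ))) := by
          simp only [Matrix.mul_assoc]; rfl
      _ = _ := by
        rw [trace_mul_comm, Matrix.mul_assoc _ _ (P.V : Matrix n n ℂ), hU, hV]
        simp only [Matrix.mul_one]
  have e1 : (trace (star Z * P.overlap * r)).re =
      ∑ j, ∑ i, P.r i * (star (Z j i) * P.overlap j i).re := by
    rw [Finset.sum_comm, hr, trace, Complex.re_sum]
    refine Finset.sum_congr rfl fun i _ => ?_
    rw [diag_apply, mul_diagonal, mul_comm, Complex.re_ofReal_mul, mul_apply, Complex.re_sum,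
      Finset.mul_sum]
    rfl
  have e2 : (trace (star Z * s * Z)).re = ∑ j, ∑ i, P.s j * ‖Z j i‖ ^ 2 := by
    rw [Finset.sum_comm, hs, trace, Complex.re_sum]
    refine Finset.sum_congr rfl fun i _ => ?_
    rw [diag_apply, mul_apply, Complex.re_sum]
    refine Finset.sum_congr rfl fun j _ => ?_
    rw [mul_diagonal, star_apply, mul_comm (star _), mul_assoc, Complex.re_ofReal_mul,
      ← Complex.normSq_eq_norm_sq, Complex.star_def, ← Complex.normSq_eq_conj_mul_self,
      Complex.ofReal_re]
  have e3 : (trace (Z * r * star Z)).re = ∑ j, ∑ i, P.r i * ‖Z j i‖ ^ 2 := by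
    rw [hr, trace, Complex.re_sum]
    refine Finset.sum_congr rfl fun i _ => ?_
    rw [diag_apply, mul_apply, Complex.re_sum]
    refine Finset.sum_congr rfl fun j _ => ?_
    rw [mul_diagonal, star_apply, mul_comm (Z _ _), mul_assoc, Complex.re_ofReal_mul,
      ← Complex.normSq_eq_norm_sq, Complex.star_def, Complex.mul_conj, Complex.ofReal_re]
  rw [variationalForm, h1, h2, h3, e1, e2, e3]
  simp only [Finset.mul_sum, ← Finset.sum_sub_distrib]
  exact Finset.sum_congr rfl fun j _ => Finset.sum_congr rfl fun i _ => by ring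

theorem isGreatest_resolventForm {t : ℝ} (ht : 0 < t) :
    IsGreatest (Set.range (variationalForm t P.left P.right)) (P.resolventForm t) := by
  constructor
  · refine ⟨P.V * (Matrix.of fun j i => ((P.r i / (P.s j + t * P.r i) : ℝ) : ℂ) * P.overlap j i) *
      star (P.U : Matrix n n ℂ), ?_⟩
    rw [variationalForm_conj, resolventForm]
    refine Finset.sum_congr rfl fun j _ => Finset.sum_congr rfl fun i _ => ?_
    rw [Matrix.of_apply]
    generalize P.overlap j i = w
    rw [star_mul', Complex.star_def, Complex.conj_ofReal,
      mul_assoc, Complex.re_ofReal_mul, ← Complex.normSq_eq_conj_mul_self, Complex.ofReal_re,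
      norm_mul, mul_pow, Complex.norm_real, Real.norm_eq_abs, sq_abs, ← Complex.normSq_eq_norm_sq]
    generalize P.s j + t * P.r i = d
    by_cases h : d = 0
    · simp [h]
    · field_simp
      ring
  · rintro _ ⟨Y, rfl⟩
    have hU : star (P.U : Matrix n n ℂ) * P.U = 1 := Unitary.coe_star_mul_self P.U
    have hU' : (P.U : Matrix n n ℂ) * star (P.U : Matrix n n ℂ) = 1 := Unitary.coe_mul_star_self P.U
    have hV' : (P.V : Matrix n n ℂ) * star (P.V : Matrix n n ℂ) = 1 := Unitary.coe_mul_star_self P.V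
    have hY : Y = P.V * (star (P.V : Matrix n n ℂ) * Y * P.U) * star (P.U : Matrix n n ℂ) := by
      rw [Matrix.mul_assoc, Matrix.mul_assoc, hU', Matrix.mul_one, ← Matrix.mul_assoc, hV',
        Matrix.one_mul]
    rw [hY, variationalForm_conj, resolventForm]
    refine Finset.sum_le_sum fun j _ => Finset.sum_le_sum fun i _ => ?_
    set z := (star (P.V : Matrix n n ℂ) * Y * P.U) j i
    set w := P.overlap j i
    have hre : (star z * w).re ≤ ‖z‖ * ‖w‖ := by
      simpa using Complex.re_le_norm (star z * w)
    have hr := P.r_nonneg i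
    have hs := P.s_nonneg j
    rcases (add_nonneg hs (mul_nonneg ht.le hr)).eq_or_lt with h | h
    · have : P.r i = 0 := by nlinarith [mul_nonneg ht.le hr]
      rw [← h]
      simp [this]
    · have key : ‖w‖ ^ 2 * (P.r i * (P.r i / (P.s j + t * P.r i))) -
          (2 * (P.r i * (‖z‖ * ‖w‖)) - (P.s j + t * P.r i) * ‖z‖ ^ 2) =
          (‖w‖ * P.r i - (P.s j + t * P.r i) * ‖z‖) ^ 2 / (P.s j + t * P.r i) := by
        generalize P.s j + t * P.r i = d at h
        have := h.ne'
        field_simp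
        ring
      have := div_nonneg (sq_nonneg (‖w‖ * P.r i - (P.s j + t * P.r i) * ‖z‖)) h.le
      nlinarith [mul_le_mul_of_nonneg_left hre hr]

theorem hasDerivAt_logForm {t : ℝ} (ht : 0 < t) :
    HasDerivAt P.logForm (P.resolventForm t) t := by
  unfold logForm resolventForm
  refine HasDerivAt.fun_sum fun j _ => HasDerivAt.fun_sum fun i _ => ?_
  refine HasDerivAt.const_mul _ ?_
  rcases (P.r_nonneg i).eq_or_lt with h | h
  · simpa [← h] using hasDerivAt_const t (0 : ℝ)
  · refine HasDerivAt.const_mul _ ?_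
    have hne : P.s j + t * P.r i ≠ 0 :=
      (add_pos_of_nonneg_of_pos (P.s_nonneg j) (mul_pos ht h)).ne'
    simpa using (((hasDerivAt_id t).mul_const (P.r i)).const_add (P.s j)).log hne

theorem continuousOn_logForm : ContinuousOn P.logForm (Set.Ici 0) := by
  intro t ht
  rcases (Set.mem_Ici.1 ht).eq_or_lt with rfl | h
  · refine ContinuousAt.continuousWithinAt ?_
    unfold logForm
    refine tendsto_finsetSum _ fun j _ => tendsto_finsetSum _ fun i _ => ?_
    by_cases hj : P.s j = 0
    · rcases P.support j i hj with h | h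
      · simp [overlap, h]
      · simp [h]
    · refine Filter.Tendsto.const_mul _ (Filter.Tendsto.const_mul _ ?_)
      have : ContinuousAt (fun t : ℝ => Real.log (P.s j + t * P.r i)) 0 :=
        ContinuousAt.log (by fun_prop) (by simpa using hj)
      exact this
  · exact (P.hasDerivAt_logForm h).continuousAt.continuousWithinAt

theorem sum_overlap (i : n) : ∑ j, ‖P.overlap j i‖ ^ 2 = 1 := by
  have hV' : (P.V : Matrix n n ℂ) * star (P.V : Matrix n n ℂ) = 1 := Unitary.coe_mul_star_self P.V
  have hU : star (P.U : Matrix n n ℂ) * P.U = 1 := Unitary.coe_star_mul_self P.U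
  have h : star P.overlap * P.overlap = 1 := by
    rw [overlap, star_mul, star_star, Matrix.mul_assoc, ← Matrix.mul_assoc _ _ (P.U : Matrix n n ℂ),
      hV', Matrix.one_mul, hU]
  have h' := congrArg Complex.re (congrFun (congrFun h i) i)
  rw [mul_apply, Complex.re_sum, one_apply_eq, Complex.one_re] at h'
  rw [← h']
  refine Finset.sum_congr rfl fun j _ => ?_
  rw [star_apply, ← Complex.normSq_eq_norm_sq, Complex.star_def, ← Complex.normSq_eq_conj_mul_self,
    Complex.ofReal_re]

theorem trace_left : P.left.trace.re = ∑ i, P.r i := by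
  have hU : star (P.U : Matrix n n ℂ) * P.U = 1 := Unitary.coe_star_mul_self P.U
  rw [left, trace_mul_comm, ← Matrix.mul_assoc, hU, Matrix.one_mul, trace_diagonal, Complex.re_sum]
  rfl

theorem sum_sum_overlap_mul (f : n → ℝ) : ∑ j, ∑ i, ‖P.overlap j i‖ ^ 2 * f i = ∑ i, f i := by
  rw [Finset.sum_comm]
  simp only [← Finset.sum_mul, sum_overlap, one_mul]

theorem relEntropy_eq :
    P.relEntropy = ∑ i, P.r i * Real.log (P.r i) - P.logForm 0 := by
  rw [← P.sum_sum_overlap_mul fun i => P.r i * Real.log (P.r i)]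
  simp only [relEntropy, logForm, ← Finset.sum_sub_distrib, zero_mul, add_zero]
  exact Finset.sum_congr rfl fun j _ => Finset.sum_congr rfl fun i _ => by ring

theorem tendsto_logForm_sub :
    Filter.Tendsto (fun t => P.logForm t - P.left.trace.re * Real.log t) Filter.atTop
      (nhds (∑ i, P.r i * Real.log (P.r i))) := by
  rw [trace_left, ← P.sum_sum_overlap_mul fun i => P.r i * Real.log (P.r i),
    ← P.sum_sum_overlap_mul P.r]
  simp only [logForm, Finset.sum_mul, ← Finset.sum_sub_distrib]
  refine tendsto_finsetSum _ fun j _ => tendsto_finsetSum _ fun i _ => ?_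
  rcases (P.r_nonneg i).eq_or_lt with h | h
  · simp [← h]
  · have hlim : Filter.Tendsto (fun t : ℝ => P.s j / t + P.r i) Filter.atTop (nhds (P.r i)) := by
      simpa using (Filter.tendsto_id.const_div_atTop (P.s j)).add_const (P.r i)
    refine (((hlim.log h.ne').const_mul (P.r i)).const_mul (‖P.overlap j i‖ ^ 2)).congr' ?_
    filter_upwards [Filter.eventually_gt_atTop 0] with t ht
    have hpos : 0 < P.s j + t * P.r i := add_pos_of_nonneg_of_pos (P.s_nonneg j) (mul_pos ht h)
    have : P.s j / t + P.r i = (P.s j + t * P.r i) / t := by field_simp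
    rw [this, Real.log_div hpos.ne' ht.ne']
    ring

/-- Joint convexity of the relative entropy. -/
theorem relEntropy_le_sum {κ : Type*} [Fintype κ] {p : κ → ℝ} (hp : ∀ k, 0 ≤ p k)
    (Q : κ → SpectralPair n) (hl : P.left = ∑ k, (p k : ℂ) • (Q k).left)
    (hr : P.right = ∑ k, (p k : ℂ) • (Q k).right) :
    P.relEntropy ≤ ∑ k, p k * (Q k).relEntropy := by
  have hres : ∀ t, 0 < t → P.resolventForm t ≤ ∑ k, p k * (Q k).resolventForm t := by
    intro t ht
    obtain ⟨Y, hY⟩ := (P.isGreatest_resolventForm ht).1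
    rw [← hY, hl, hr, variationalForm_sum]
    exact Finset.sum_le_sum fun k _ =>
      mul_le_mul_of_nonneg_left (((Q k).isGreatest_resolventForm ht).2 ⟨Y, rfl⟩) (hp k)
  have htr : P.left.trace.re = ∑ k, p k * (Q k).left.trace.re := by
    simp only [hl, trace_sum, trace_smul, smul_eq_mul, Complex.re_sum, Complex.re_ofReal_mul]
  have hd : ∀ t, 0 < t → HasDerivAt (fun t => ∑ k, p k * (Q k).logForm t - P.logForm t)
      (∑ k, p k * (Q k).resolventForm t - P.resolventForm t) t := fun t ht =>
    (HasDerivAt.fun_sum fun k _ => ((Q k).hasDerivAt_logForm ht).const_mul (p k)).sub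
      (P.hasDerivAt_logForm ht)
  have hmono : MonotoneOn (fun t => ∑ k, p k * (Q k).logForm t - P.logForm t) (Set.Ici 0) := by
    refine monotoneOn_of_deriv_nonneg (convex_Ici 0) ?_ ?_ ?_
    · exact (continuousOn_finsetSum _ fun k _ =>
        (Q k).continuousOn_logForm.const_mul (p k)).sub P.continuousOn_logForm
    · rw [interior_Ici]
      exact fun t ht => (hd t ht).differentiableAt.differentiableWithinAt
    · rw [interior_Ici]
      intro t ht
      rw [(hd t ht).deriv]
      exact sub_nonneg.2 (hres t ht)
  have hlim := (tendsto_finsetSum Finset.univ fun k _ =>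
    ((Q k).tendsto_logForm_sub).const_mul (p k)).sub P.tendsto_logForm_sub
  have hle := ge_of_tendsto (b := ∑ k, p k * (Q k).logForm 0 - P.logForm 0) hlim <| by
    filter_upwards [Filter.eventually_ge_atTop 0] with t ht
    refine (hmono Set.self_mem_Ici ht ht).trans_eq ?_
    simp only [htr, mul_sub, Finset.sum_sub_distrib, Finset.sum_mul, mul_assoc]
    ring
  simp only [relEntropy_eq, mul_sub, Finset.sum_sub_distrib]
  linarith

end SpectralPair

theorem ptrA_sum_smul {α β κ : Type*} [Fintype α] [Fintype κ] (c : κ → ℂ)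
    (M : κ → Matrix (α × β) (α × β) ℂ) :
    ptrA (∑ k, c k • M k) = ∑ k, c k • ptrA (M k) := by
  ext i j
  simp only [ptrA, of_apply, Matrix.sum_apply, Matrix.smul_apply, Finset.smul_sum]
  exact Finset.sum_comm

theorem Matrix.PosSemidef.ptrA {α β : Type*} [Fintype α] {M : Matrix (α × β) (α × β) ℂ}
    (hM : M.PosSemidef) : (_root_.ptrA M).PosSemidef := by
  have : _root_.ptrA M = ∑ a, M.submatrix (Prod.mk a) (Prod.mk a) := by
    ext i j
    simp [_root_.ptrA, Matrix.sum_apply]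
  rw [this]
  exact posSemidef_sum _ fun a _ => hM.submatrix _

theorem ptrA_conj_one_kronecker {α β : Type*} [Fintype α] [DecidableEq α] [Fintype β]
    (M : Matrix (α × β) (α × β) ℂ) (K L : Matrix β β ℂ) :
    ptrA ((1 : Matrix α α ℂ) ⊗ₖ K * M * (1 : Matrix α α ℂ) ⊗ₖ L) = K * ptrA M * L := by
  ext i j
  simp only [ptrA, of_apply, mul_apply, Fintype.sum_prod_type, kroneckerMap_apply, one_apply,
    ite_mul, one_mul, zero_mul, mul_ite, mul_zero, Finset.sum_ite_irrel, Finset.sum_const_zero,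
    Finset.sum_ite_eq, Finset.sum_ite_eq', Finset.mem_univ, if_true, Finset.sum_mul,
    Finset.mul_sum]
  rw [Finset.sum_comm]
  refine Finset.sum_congr rfl fun _ _ => ?_
  rw [Finset.sum_comm]

theorem Matrix.IsHermitian.star_eigenvectorUnitary_mul_mul {n : Type*} [Fintype n] [DecidableEq n]
    {M : Matrix n n ℂ} (hM : M.IsHermitian) :
    star (hM.eigenvectorUnitary : Matrix n n ℂ) * M * hM.eigenvectorUnitary =
      diagonal fun i => (hM.eigenvalues i : ℂ) := by
  have h := hM.conjStarAlgAut_star_eigenvectorUnitary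
  rw [Unitary.conjStarAlgAut_star_apply] at h
  exact h

section ConditionalEntropy

variable {α β : Type*} [Fintype α] [DecidableEq α] [Fintype β] [DecidableEq β]
  {M : Matrix (α × β) (α × β) ℂ}

theorem sum_overlap_eigenvalues_ptrA (hM : M.PosSemidef) (b : β) :
    ∑ a, ∑ i, ‖(star ((1 : Matrix α α ℂ) ⊗ₖ
      (hM.ptrA.isHermitian.eigenvectorUnitary : Matrix β β ℂ)) *
        hM.isHermitian.eigenvectorUnitary) (a, b) i‖ ^ 2 * hM.isHermitian.eigenvalues i =
      hM.ptrA.isHermitian.eigenvalues b := by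
  set K := (hM.ptrA.isHermitian.eigenvectorUnitary : Matrix β β ℂ) with hK
  set U := (hM.isHermitian.eigenvectorUnitary : Matrix (α × β) (α × β) ℂ) with hU
  set W := star ((1 : Matrix α α ℂ) ⊗ₖ K) * U with hW
  have hUU : U * star U = 1 := Unitary.coe_mul_star_self _
  have hWM : W * diagonal (fun i => (hM.isHermitian.eigenvalues i : ℂ)) * star W =
      (1 : Matrix α α ℂ) ⊗ₖ star K * M * (1 : Matrix α α ℂ) ⊗ₖ K := by
    rw [← hM.isHermitian.star_eigenvectorUnitary_mul_mul, ← hU, hW, star_mul, star_star]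
    calc _ = star ((1 : Matrix α α ℂ) ⊗ₖ K) * (U * star U) * M * (U * star U) *
          (1 : Matrix α α ℂ) ⊗ₖ K := by simp only [Matrix.mul_assoc]
      _ = _ := by
        rw [hUU, Matrix.mul_one, Matrix.mul_one, star_eq_conjTranspose, conjTranspose_kronecker,
          conjTranspose_one, star_eq_conjTranspose]
  have h := congrArg ptrA hWM
  rw [ptrA_conj_one_kronecker, hK, hM.ptrA.isHermitian.star_eigenvectorUnitary_mul_mul] at h
  have hb := congrArg Complex.re (congrFun (congrFun h b) b)
  rw [diagonal_apply_eq, Complex.ofReal_re, ptrA, of_apply, Complex.re_sum] at hb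
  rw [← hb]
  refine Finset.sum_congr rfl fun a _ => ?_
  rw [mul_apply, Complex.re_sum]
  refine Finset.sum_congr rfl fun i _ => ?_
  rw [mul_diagonal, star_apply, mul_comm (W _ _), mul_assoc, Complex.re_ofReal_mul,
    ← Complex.normSq_eq_norm_sq, Complex.star_def, Complex.mul_conj, Complex.ofReal_re, mul_comm]

/-- The pair of `M` and the tensor product of the identity with the partial trace of `M`. -/
noncomputable def SpectralPair.ofMarginal (hM : M.PosSemidef) : SpectralPair (α × β) where
  U := hM.isHermitian.eigenvectorUnitary
  V := ⟨_, kronecker_mem_unitary (one_mem _) hM.ptrA.isHermitian.eigenvectorUnitary.2⟩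
  r := hM.isHermitian.eigenvalues
  s x := hM.ptrA.isHermitian.eigenvalues x.2
  r_nonneg := hM.eigenvalues_nonneg
  s_nonneg x := hM.ptrA.eigenvalues_nonneg x.2
  support := by
    rintro ⟨a, b⟩ i h
    have key := sum_overlap_eigenvalues_ptrA hM b
    rw [h] at key
    have hnn := fun a i => mul_nonneg (sq_nonneg ‖(star ((1 : Matrix α α ℂ) ⊗ₖ
      (hM.ptrA.isHermitian.eigenvectorUnitary : Matrix β β ℂ)) *
        hM.isHermitian.eigenvectorUnitary) (a, b) i‖) (hM.eigenvalues_nonneg i)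
    rw [Finset.sum_eq_zero_iff_of_nonneg fun a _ => Finset.sum_nonneg fun i _ => hnn a i] at key
    have key' := key a (Finset.mem_univ a)
    rw [Finset.sum_eq_zero_iff_of_nonneg fun i _ => hnn a i] at key'
    simpa using key' i (Finset.mem_univ i)

theorem SpectralPair.ofMarginal_left (hM : M.PosSemidef) : (ofMarginal hM).left = M :=
  (hM.isHermitian.spectral_theorem.trans (Unitary.conjStarAlgAut_apply _ _)).symm

theorem SpectralPair.ofMarginal_right (hM : M.PosSemidef) :
    (ofMarginal hM).right = (1 : Matrix α α ℂ) ⊗ₖ ptrA M := by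
  have h := hM.ptrA.isHermitian.spectral_theorem.trans (Unitary.conjStarAlgAut_apply _ _)
  have hd : diagonal (fun x : α × β => (hM.ptrA.isHermitian.eigenvalues x.2 : ℂ)) =
      (1 : Matrix α α ℂ) ⊗ₖ diagonal fun b => (hM.ptrA.isHermitian.eigenvalues b : ℂ) := by
    rw [← diagonal_one, diagonal_kronecker_diagonal]
    simp
  conv_rhs => rw [h]
  simp only [right, ofMarginal]
  rw [hd, star_eq_conjTranspose, conjTranspose_kronecker, conjTranspose_one, ← mul_kronecker_mul,
    ← mul_kronecker_mul, Matrix.one_mul, Matrix.one_mul]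
  rfl

theorem SpectralPair.ofMarginal_relEntropy (hM : M.PosSemidef) :
    (ofMarginal hM).relEntropy = Real.log 2 * (vnEntropy (ptrA M) - vnEntropy M) := by
  have hlog : (ofMarginal hM).logForm 0 = ∑ b, hM.ptrA.isHermitian.eigenvalues b *
      Real.log (hM.ptrA.isHermitian.eigenvalues b) := by
    simp only [logForm, zero_mul, add_zero]
    rw [Fintype.sum_prod_type, Finset.sum_comm]
    refine Finset.sum_congr rfl fun b _ => ?_
    refine Eq.trans ?_ (congrArg (· * Real.log (hM.ptrA.isHermitian.eigenvalues b))
      (sum_overlap_eigenvalues_ptrA hM b))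
    simp only [Finset.sum_mul]
    exact Finset.sum_congr rfl fun a _ => Finset.sum_congr rfl fun i _ => (mul_assoc _ _ _).symm
  have h2 : Real.log 2 ≠ 0 := (Real.log_pos one_lt_two).ne'
  rw [relEntropy_eq, hlog, vnEntropy, vnEntropy, dif_pos hM.isHermitian,
    dif_pos hM.ptrA.isHermitian]
  simp only [Real.logb, ← mul_div_assoc, ← Finset.sum_div]
  field_simp
  simp only [ofMarginal]
  ring

end ConditionalEntropy

/-- Concavity of the conditional entropy. -/
theorem vnEntropy_ptrA_sub_le_sum {α β κ : Type*} [Fintype α] [DecidableEq α] [Fintype β]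
    [DecidableEq β] [Fintype κ] {p : κ → ℝ} (hp : ∀ k, 0 ≤ p k)
    {M : κ → Matrix (α × β) (α × β) ℂ} (hM : ∀ k, (M k).PosSemidef) :
    vnEntropy (ptrA (∑ k, (p k : ℂ) • M k)) - vnEntropy (∑ k, (p k : ℂ) • M k) ≤
      ∑ k, p k * (vnEntropy (ptrA (M k)) - vnEntropy (M k)) := by
  have hsum : (∑ k, (p k : ℂ) • M k).PosSemidef :=
    posSemidef_sum _ fun k _ => (hM k).smul (by exact_mod_cast hp k)
  have h := (SpectralPair.ofMarginal hsum).relEntropy_le_sum hp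
    (fun k => SpectralPair.ofMarginal (hM k))
    (by simp only [SpectralPair.ofMarginal_left])
    (by
      simp only [SpectralPair.ofMarginal_right, ptrA_sum_smul]
      ext x y
      simp only [kroneckerMap_apply, Matrix.sum_apply, Matrix.smul_apply, Finset.mul_sum,
        smul_eq_mul]
      exact Finset.sum_congr rfl fun k _ => by ring)
  simp only [SpectralPair.ofMarginal_relEntropy, mul_left_comm _ (Real.log 2),
    ← Finset.mul_sum] at h
  exact le_of_mul_le_mul_left h (Real.log_pos one_lt_two)

theorem IsCPTP.posSemidef_idTensor {A B R : Type*} [Fintype A] [Fintype B] [Fintype R]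
    {Λ : Matrix A A ℂ → Matrix B B ℂ} (hΛ : IsCPTP Λ) {M : Matrix (R × A) (R × A) ℂ}
    (hM : M.PosSemidef) : (idTensor Λ M).PosSemidef := by
  let e := Fintype.equivFin R
  exact (hΛ.2.2.2 _ _ (hM.submatrix (Prod.map e.symm id))).submatrix (Prod.map e id) |> fun h => by
    convert h using 1
    ext x y
    simp [idTensor]

theorem IsCPTP.ptrA_idTensor {A B R : Type*} [Fintype A] [Fintype B] [Fintype R]
    {Λ : Matrix A A ℂ → Matrix B B ℂ} (hΛ : IsCPTP Λ) (M : Matrix (R × A) (R × A) ℂ) :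
    ptrA (idTensor Λ M) = Λ (ptrA M) := by
  let L : Matrix A A ℂ →ₗ[ℂ] Matrix B B ℂ :=
    { toFun := Λ, map_add' := hΛ.1, map_smul' := hΛ.2.1 }
  have h : ptrA M = ∑ x, Matrix.of fun a a' => M (x, a) (x, a') := by
    ext i j
    simp [ptrA, Matrix.sum_apply]
  have h' : Λ (ptrA M) = ∑ x, Λ (Matrix.of fun a a' => M (x, a) (x, a')) := by
    rw [h]
    exact map_sum L _ _
  rw [h']
  ext i j
  simp [ptrA, idTensor, Matrix.sum_apply]

theorem stmt13 {A R ι : Type*} [Fintype A] [DecidableEq A] [Fintype R] [DecidableEq R]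
    [Fintype ι]
    (p : ι → ℝ) (hp0 : ∀ i, 0 ≤ p i) (hp1 : ∑ i, p i = 1)
    (Λi : ι → (Matrix A A ℂ → Matrix A A ℂ)) (hΛi : ∀ i, IsCPTP (Λi i))
    (Λ : Matrix A A ℂ → Matrix A A ℂ)
    (hΛ : ∀ M, Λ M = ∑ i, (p i : ℂ) • Λi i M)
    (ρ : Matrix A A ℂ) (hρ : IsDensity ρ)
    (ψ : R × A → ℂ) (hψ : ptrA (Matrix.vecMulVec ψ (star ψ)) = ρ) :
    vnEntropy (Λ ρ) - vnEntropy (idTensor Λ (Matrix.vecMulVec ψ (star ψ)))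
      ≤ ∑ i, p i *
        (vnEntropy (Λi i ρ) - vnEntropy (idTensor (Λi i) (Matrix.vecMulVec ψ (star ψ)))) := by
  have hid : idTensor Λ (vecMulVec ψ (star ψ)) =
      ∑ i, (p i : ℂ) • idTensor (Λi i) (vecMulVec ψ (star ψ)) := by
    ext x y
    simp [idTensor, hΛ, Matrix.sum_apply]
  have hmarg : ∀ i, Λi i ρ = ptrA (idTensor (Λi i) (vecMulVec ψ (star ψ))) := fun i => by
    rw [(hΛi i).ptrA_idTensor, hψ]
  have hmix : Λ ρ = ptrA (∑ i, (p i : ℂ) • idTensor (Λi i) (vecMulVec ψ (star ψ))) := by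
    rw [hΛ, ptrA_sum_smul]
    simp only [hmarg]
  rw [hid, hmix]
  simp only [hmarg]
  exact vnEntropy_ptrA_sub_le_sum hp0 fun i =>
    (hΛi i).posSemidef_idTensor (posSemidef_vecMulVec_self_star ψ)
end

section
/- If a quantum channel Λ is anti-degradable, i.e., Λ = Γ ∘ Λ^c for some channel Γ with Λ^c a complementary channel of Λ, then for every input state ρ the coherent information satisfies I_c(ρ,Λ) = S(Λ(ρ)) − S(Λ^c(ρ)) ≤ 0. -/
open Matrix Kronecker BigOperators
open scoped ComplexOrder

theorem sum_mul_log_le_of_resolvent_le {ι : Type*} [Fintype ι] (w a c : ι → ℝ)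
    (hpos : ∀ i, w i ≠ 0 → 0 < a i ∧ 0 < c i)
    (h : ∀ t : ℝ, 0 < t → ∑ i, w i * (t + a i)⁻¹ ≤ ∑ i, w i * (t + c i)⁻¹) :
    ∑ i, w i * Real.log (c i) ≤ ∑ i, w i * Real.log (a i) := by
  let F : ℝ → ℝ := fun t => ∑ i, w i * (Real.log (t + a i) - Real.log (t + c i))
  have hder : ∀ t : ℝ, 0 ≤ t →
      HasDerivAt F (∑ i, w i * ((t + a i)⁻¹ - (t + c i)⁻¹)) t := by
    intro t ht
    apply HasDerivAt.fun_sum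
    intro i _
    by_cases hw : w i = 0
    · simpa [hw] using hasDerivAt_const t (0 : ℝ)
    obtain ⟨ha, hc⟩ := hpos i hw
    have h1 := (((hasDerivAt_id t).add_const (a i)).log (by simp; positivity))
    have h2 := (((hasDerivAt_id t).add_const (c i)).log (by simp; positivity))
    simpa using (h1.sub h2).const_mul (w i)
  have hanti : AntitoneOn F (Set.Ici 0) := by
    apply antitoneOn_of_deriv_nonpos (convex_Ici 0)
    · exact fun t ht => (hder t ht).continuousAt.continuousWithinAt
    · intro t ht
      rw [interior_Ici] at ht
      exact (hder t (le_of_lt ht)).differentiableAt.differentiableWithinAt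
    · intro t ht
      rw [interior_Ici] at ht
      rw [(hder t (le_of_lt ht)).deriv]
      simp only [mul_sub, Finset.sum_sub_distrib]
      linarith [h t ht]
  have hlim : Filter.Tendsto F Filter.atTop (nhds 0) := by
    have : (0 : ℝ) = ∑ i : ι, w i * (0 - 0) := by simp
    rw [this]
    refine tendsto_finsetSum _ fun i _ => ?_
    have key : ∀ x : ℝ, Filter.Tendsto (fun t => Real.log (t + x) - Real.log t)
        Filter.atTop (nhds 0) := fun x => Real.tendsto_log_comp_add_sub_log x
    have := ((key (a i)).sub (key (c i))).const_mul (w i)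
    simpa using this
  have h0 : 0 ≤ F 0 := by
    refine le_of_tendsto hlim ?_
    filter_upwards [Filter.eventually_ge_atTop 0] with t ht
    exact hanti (Set.mem_Ici.2 le_rfl) ht ht
  simp only [F, zero_add, mul_sub, Finset.sum_sub_distrib] at h0
  linarith

theorem re_trace_mul_conjTranspose_mul_self_nonneg {m n : Type*} [Fintype m] [Fintype n]
    {ρ : Matrix n n ℂ} (hρ : ρ.PosSemidef) (A : Matrix m n ℂ) :
    0 ≤ (ρ * (Aᴴ * A)).trace.re := by
  rw [← Matrix.mul_assoc, Matrix.trace_mul_comm, ← Matrix.mul_assoc]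
  exact (Complex.nonneg_iff.1 (hρ.mul_mul_conjTranspose_same A).trace_nonneg).1

/-- The Kadison-Schwarz inequality, traced against a positive matrix. -/
theorem re_trace_schwarz {m n κ : Type*} [Fintype m] [DecidableEq m] [Fintype n] [Fintype κ]
    (S : κ → Matrix n m ℂ) (hS : ∑ k, (S k)ᴴ * S k = 1) {ρ : Matrix m m ℂ}
    (hρ : ρ.PosSemidef) (Y : Matrix n n ℂ) :
    (ρ * ((∑ k, (S k)ᴴ * Y * S k)ᴴ * (∑ k, (S k)ᴴ * Y * S k))).trace.re ≤
      ((∑ k, S k * ρ * (S k)ᴴ) * (Yᴴ * Y)).trace.re := by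
  set X := ∑ k, (S k)ᴴ * Y * S k with hX
  have hX' : Xᴴ = ∑ k, (S k)ᴴ * Yᴴ * S k := by
    simp [hX, conjTranspose_sum, Matrix.mul_assoc]
  have h1 : ((∑ k, S k * ρ * (S k)ᴴ) * (Yᴴ * Y)).trace =
      (ρ * ∑ k, (S k)ᴴ * (Yᴴ * Y) * S k).trace := by
    rw [Finset.sum_mul, Finset.mul_sum, trace_sum, trace_sum]
    refine Finset.sum_congr rfl fun k _ => ?_
    rw [Matrix.mul_assoc, Matrix.mul_assoc, Matrix.trace_mul_comm]
    simp only [Matrix.mul_assoc]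
  have h2 : ∑ k, (Y * S k - S k * X)ᴴ * (Y * S k - S k * X) =
      (∑ k, (S k)ᴴ * (Yᴴ * Y) * S k) - Xᴴ * X := by
    have e : ∀ k, (Y * S k - S k * X)ᴴ * (Y * S k - S k * X) =
        (S k)ᴴ * (Yᴴ * Y) * S k - ((S k)ᴴ * Yᴴ * S k) * X - Xᴴ * ((S k)ᴴ * Y * S k)
          + Xᴴ * ((S k)ᴴ * S k) * X := by
      intro k
      simp only [conjTranspose_sub, conjTranspose_mul, Matrix.mul_sub, Matrix.sub_mul,
        Matrix.mul_assoc]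
      abel
    simp only [e, Finset.sum_add_distrib, Finset.sum_sub_distrib, ← Finset.sum_mul,
      ← Finset.mul_sum, hS, ← hX', ← hX]
    simp
  have h3 : 0 ≤ (ρ * ∑ k, (Y * S k - S k * X)ᴴ * (Y * S k - S k * X)).trace.re := by
    rw [Finset.mul_sum, trace_sum, Complex.re_sum]
    exact Finset.sum_nonneg fun k _ => re_trace_mul_conjTranspose_mul_self_nonneg hρ _
  rw [h2, Matrix.mul_sub, trace_sub, Complex.sub_re] at h3
  rw [h1]
  linarith

/-- The functional whose supremum over `X` is the resolvent of the relative modular operator. -/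
noncomputable def resolventFunctional {m : Type*} [Fintype m] (t : ℝ) (ρ σ X : Matrix m m ℂ) : ℝ :=
  2 * (ρ * X).trace.re - t * (ρ * (Xᴴ * X)).trace.re - (σ * (X * Xᴴ)).trace.re

theorem resolventFunctional_le_adjoint {m n κ : Type*} [Fintype m] [DecidableEq m] [Fintype n]
    [Fintype κ] (S : κ → Matrix n m ℂ) (hS : ∑ k, (S k)ᴴ * S k = 1) {t : ℝ} (ht : 0 ≤ t)
    {ρ σ : Matrix m m ℂ} (hρ : ρ.PosSemidef) (hσ : σ.PosSemidef) (Y : Matrix n n ℂ) :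
    resolventFunctional t (∑ k, S k * ρ * (S k)ᴴ) (∑ k, S k * σ * (S k)ᴴ) Y ≤
      resolventFunctional t ρ σ (∑ k, (S k)ᴴ * Y * S k) := by
  have h1 := mul_le_mul_of_nonneg_left (re_trace_schwarz S hS hρ Y) ht
  have h2 := re_trace_schwarz S hS hσ Yᴴ
  have hX' : ∑ k, (S k)ᴴ * Yᴴ * S k = (∑ k, (S k)ᴴ * Y * S k)ᴴ := by
    simp [conjTranspose_sum, Matrix.mul_assoc]
  have h3 : ((∑ k, S k * ρ * (S k)ᴴ) * Y).trace = (ρ * ∑ k, (S k)ᴴ * Y * S k).trace := by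
    rw [Finset.sum_mul, Finset.mul_sum, trace_sum, trace_sum]
    refine Finset.sum_congr rfl fun k _ => ?_
    rw [Matrix.mul_assoc, Matrix.mul_assoc, Matrix.trace_mul_comm]
    simp only [Matrix.mul_assoc]
  simp only [hX', conjTranspose_conjTranspose] at h2
  simp only [resolventFunctional, h3]
  linarith

theorem re_trace_conjTranspose_mul {m n : Type*} [Fintype m] [Fintype n]
    (A B : Matrix m n ℂ) :
    (Aᴴ * B).trace.re = ∑ i, ∑ j, (star (A i j) * B i j).re := by
  simp only [trace, diag_apply, Matrix.mul_apply, conjTranspose_apply, Complex.re_sum]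
  exact Finset.sum_comm

theorem exists_resolventFunctional_eq {n ε : Type*} [Fintype n] [DecidableEq n] [Fintype ε]
    [DecidableEq ε] (t : ℝ) (Φ : Matrix n ε ℂ) (P : n → ℝ) (q : ε → ℝ)
    (hq : Φᴴ * Φ = diagonal fun e => (q e : ℂ)) :
    ∃ Y, resolventFunctional t (Φ * Φᴴ) (diagonal fun i => (P i : ℂ)) Y =
      ∑ i, ∑ e, Complex.normSq (Φ i e) * (q e / (P i + t * q e)) := by
  let D : Matrix n ε ℂ := of fun i e => Φ i e / ((P i + t * q e : ℝ) : ℂ)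
  have hYΦ : D * Φᴴ * Φ = D * diagonal fun e => (q e : ℂ) := by rw [Matrix.mul_assoc, hq]
  refine ⟨D * Φᴴ, ?_⟩
  have h1 : (Φ * Φᴴ * (D * Φᴴ)).trace = (Φᴴ * (D * diagonal fun e => (q e : ℂ))).trace := by
    rw [← hYΦ, Matrix.mul_assoc, Matrix.trace_mul_comm, Matrix.mul_assoc]
  have h2 : (Φ * Φᴴ * ((D * Φᴴ)ᴴ * (D * Φᴴ))).trace =
      ((D * diagonal fun e => (q e : ℂ))ᴴ * (D * diagonal fun e => (q e : ℂ))).trace := by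
    rw [← hYΦ, Matrix.mul_assoc, Matrix.trace_mul_comm, conjTranspose_mul (D * Φᴴ) Φ]
    simp only [Matrix.mul_assoc]
  have h3 : ((diagonal fun i => (P i : ℂ)) * (D * Φᴴ * (D * Φᴴ)ᴴ)).trace =
      (Dᴴ * ((diagonal fun i => (P i : ℂ)) * (D * diagonal fun e => (q e : ℂ)))).trace := by
    rw [Matrix.trace_mul_comm Dᴴ, ← hYΦ]
    simp only [Matrix.mul_assoc, conjTranspose_mul, conjTranspose_conjTranspose]
  rw [resolventFunctional, h1, h2, h3, re_trace_conjTranspose_mul, re_trace_conjTranspose_mul,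
    re_trace_conjTranspose_mul, Finset.mul_sum, Finset.mul_sum, ← Finset.sum_sub_distrib,
    ← Finset.sum_sub_distrib]
  refine Finset.sum_congr rfl fun i _ => ?_
  rw [Finset.mul_sum, Finset.mul_sum, ← Finset.sum_sub_distrib, ← Finset.sum_sub_distrib]
  refine Finset.sum_congr rfl fun e _ => ?_
  simp only [D, mul_diagonal, diagonal_mul, of_apply]
  by_cases hz : P i + t * q e = 0
  · simp [hz]
  have e1 : (star (Φ i e) * (Φ i e / ((P i + t * q e : ℝ) : ℂ) * (q e : ℂ))).re =
      Complex.normSq (Φ i e) * (q e / (P i + t * q e)) := by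
    rw [← Complex.ofReal_re (Complex.normSq (Φ i e) * (q e / (P i + t * q e)))]
    congr 1
    push_cast [Complex.normSq_eq_conj_mul_self]
    simp only [Complex.star_def]
    ring
  have e2 : (star (Φ i e / ((P i + t * q e : ℝ) : ℂ) * (q e : ℂ)) *
      (Φ i e / ((P i + t * q e : ℝ) : ℂ) * (q e : ℂ))).re =
      Complex.normSq (Φ i e) * (q e / (P i + t * q e)) ^ 2 := by
    rw [← Complex.ofReal_re (Complex.normSq (Φ i e) * (q e / (P i + t * q e)) ^ 2)]
    congr 1
    push_cast [Complex.normSq_eq_conj_mul_self]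
    simp only [Complex.star_def, map_mul, map_div₀, map_add, Complex.conj_ofReal]
    ring
  have e3 : (star (Φ i e / ((P i + t * q e : ℝ) : ℂ)) *
      ((P i : ℂ) * (Φ i e / ((P i + t * q e : ℝ) : ℂ) * (q e : ℂ)))).re =
      Complex.normSq (Φ i e) * (P i * (q e / (P i + t * q e)) / (P i + t * q e)) := by
    rw [← Complex.ofReal_re
      (Complex.normSq (Φ i e) * (P i * (q e / (P i + t * q e)) / (P i + t * q e)))]
    congr 1
    push_cast [Complex.normSq_eq_conj_mul_self]
    simp only [Complex.star_def, map_mul, map_div₀, map_add, Complex.conj_ofReal]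
    ring
  rw [e1, e2, e3]
  generalize hs : P i + t * q e = s at hz
  rw [eq_sub_of_add_eq hs]
  field_simp
  ring

theorem two_re_sub_le_resolvent {p Q t : ℝ} (hp : 0 < p) (hQ : 0 ≤ Q) (ht : 0 < t) (z x : ℂ) :
    2 * (star z * x).re - t * Complex.normSq x - Q * (Complex.normSq x / p) ≤
      Complex.normSq z * (p / (Q + t * p)) := by
  have hs : 0 < Q + t * p := by positivity
  have h2 : Complex.normSq z * (p / (Q + t * p)) -
      (2 * (star z * x).re - t * Complex.normSq x - Q * (Complex.normSq x / p)) =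
      Complex.normSq (p * z - (Q + t * p) * x) / (p * (Q + t * p)) := by
    simp only [Complex.normSq_apply, Complex.star_def, Complex.mul_re, Complex.mul_im,
      Complex.sub_re, Complex.sub_im, Complex.conj_re, Complex.conj_im, Complex.ofReal_re,
      Complex.ofReal_im, Complex.add_re, Complex.add_im]
    field_simp
    ring
  have : 0 ≤ Complex.normSq (p * z - (Q + t * p) * x) / (p * (Q + t * p)) :=
    div_nonneg (Complex.normSq_nonneg _) (by positivity)
  linarith

theorem resolventFunctional_le {m β : Type*} [Fintype m] [DecidableEq m] [Fintype β]
    [DecidableEq β] {t : ℝ} (ht : 0 < t) (Ψ : Matrix m β ℂ) (Q : m → ℝ) (hQ : ∀ i, 0 ≤ Q i)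
    (p : β → ℝ) (hp : Ψᴴ * Ψ = diagonal fun b => (p b : ℂ)) (X : Matrix m m ℂ) :
    resolventFunctional t (Ψ * Ψᴴ) (diagonal fun i => (Q i : ℂ)) X ≤
      ∑ i, ∑ b, Complex.normSq (Ψ i b) * (p b / (Q i + t * p b)) := by
  have hpb : ∀ b, p b = ∑ i, Complex.normSq (Ψ i b) := by
    intro b
    have := congrFun (congrFun hp b) b
    simp only [Matrix.mul_apply, conjTranspose_apply, diagonal_apply_eq] at this
    simp only [Complex.star_def, ← Complex.normSq_eq_conj_mul_self] at this
    exact_mod_cast this.symm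
  have hp0 : ∀ b, 0 ≤ p b := fun b =>
    hpb b ▸ Finset.sum_nonneg fun i _ => Complex.normSq_nonneg _
  have hΨ0 : ∀ b, p b = 0 → ∀ i, Ψ i b = 0 := by
    intro b hb i
    rw [hpb b, Finset.sum_eq_zero_iff_of_nonneg fun i _ => Complex.normSq_nonneg _] at hb
    exact Complex.normSq_eq_zero.1 (hb i (Finset.mem_univ i))
  let J : Matrix β β ℂ := diagonal fun b => ((p b)⁻¹ : ℂ)
  let H : Matrix m m ℂ := diagonal fun i => (Q i : ℂ)
  let G : Matrix m m ℂ := Ψ * J * Ψᴴ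
  have hJ : Jᴴ = J := by
    simp only [J, diagonal_conjTranspose]
    congr 1
    ext b
    simp
  have hG : Gᴴ = G := by
    simp [G, hJ, Matrix.mul_assoc]
  have hGG : G * G = G := by
    have : J * (Ψᴴ * Ψ) * J = J := by
      simp only [J, hp, diagonal_mul_diagonal]
      congr 1
      ext b
      by_cases hb : (p b : ℂ) = 0 <;> simp [hb]
    calc G * G = Ψ * (J * (Ψᴴ * Ψ) * J) * Ψᴴ := by simp only [G, Matrix.mul_assoc]
      _ = G := by rw [this]
  have hHpos : H.PosSemidef := by
    refine PosSemidef.diagonal fun i => ?_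
    simpa using hQ i
  have hproj : ((Ψ * J * Ψᴴ) * (Xᴴ * H * X)).trace.re ≤ (H * (X * Xᴴ)).trace.re := by
    have h1 := (Complex.nonneg_iff.1
      (hHpos.conjTranspose_mul_mul_same (X * (1 - G))).trace_nonneg).1
    have h2 : ((X * (1 - G))ᴴ * H * (X * (1 - G))).trace =
        (H * (X * Xᴴ)).trace - (G * (Xᴴ * H * X)).trace := by
      have h3 : (1 - G) * (1 - G)ᴴ = 1 - G := by
        simp only [conjTranspose_sub, hG, conjTranspose_one, Matrix.mul_sub, Matrix.sub_mul,
          Matrix.mul_one, Matrix.one_mul, hGG]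
        simp
      calc ((X * (1 - G))ᴴ * H * (X * (1 - G))).trace
          = ((1 - G)ᴴ * (Xᴴ * H * X * (1 - G))).trace := by
            simp only [conjTranspose_mul, Matrix.mul_assoc]
        _ = (Xᴴ * H * X * ((1 - G) * (1 - G)ᴴ)).trace := by
            rw [Matrix.trace_mul_comm, Matrix.mul_assoc]
        _ = _ := by
            rw [h3, Matrix.mul_sub, trace_sub, Matrix.mul_one, Matrix.trace_mul_comm _ G]
            congr 1
            rw [Matrix.mul_assoc, Matrix.trace_mul_comm, Matrix.mul_assoc]
    rw [h2, Complex.sub_re] at h1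
    linarith
  have h1 : (Ψ * Ψᴴ * X).trace = (Ψᴴ * (X * Ψ)).trace := by
    rw [Matrix.mul_assoc, Matrix.trace_mul_comm, Matrix.mul_assoc]
  have h2 : (Ψ * Ψᴴ * (Xᴴ * X)).trace = ((X * Ψ)ᴴ * (X * Ψ)).trace := by
    rw [Matrix.mul_assoc, Matrix.trace_mul_comm, conjTranspose_mul]
    simp only [Matrix.mul_assoc]
  have h3 : ((Ψ * J * Ψᴴ) * (Xᴴ * H * X)).trace = ((X * Ψ)ᴴ * (H * (X * Ψ) * J)).trace := by
    rw [Matrix.mul_assoc, Matrix.mul_assoc, Matrix.trace_mul_comm, Matrix.mul_assoc,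
      Matrix.trace_mul_comm, conjTranspose_mul]
    simp only [Matrix.mul_assoc]
  have h4 : resolventFunctional t (Ψ * Ψᴴ) H X ≤ 2 * (Ψᴴ * (X * Ψ)).trace.re -
      t * ((X * Ψ)ᴴ * (X * Ψ)).trace.re - ((X * Ψ)ᴴ * (H * (X * Ψ) * J)).trace.re := by
    rw [resolventFunctional, h1, h2, ← h3]
    linarith
  refine h4.trans ?_
  have hx0 : ∀ b, p b = 0 → ∀ i, (X * Ψ) i b = 0 := fun b hb i => by
    simp [Matrix.mul_apply, hΨ0 b hb]
  generalize X * Ψ = x at hx0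
  rw [re_trace_conjTranspose_mul, re_trace_conjTranspose_mul,
    re_trace_conjTranspose_mul, Finset.mul_sum, Finset.mul_sum, ← Finset.sum_sub_distrib,
    ← Finset.sum_sub_distrib]
  refine Finset.sum_le_sum fun i _ => ?_
  rw [Finset.mul_sum, Finset.mul_sum, ← Finset.sum_sub_distrib, ← Finset.sum_sub_distrib]
  refine Finset.sum_le_sum fun b _ => ?_
  rcases (hp0 b).eq_or_lt with hb | hb
  · simp [hx0 b hb.symm, hΨ0 b hb.symm]
  refine le_of_eq_of_le ?_ (two_re_sub_le_resolvent hb (hQ i) ht (Ψ i b) (x i b))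
  have e2 : (star (x i b) * x i b).re = Complex.normSq (x i b) := by
    rw [Complex.star_def, ← Complex.normSq_eq_conj_mul_self, Complex.ofReal_re]
  have e3 : (star (x i b) * (H * x * J) i b).re = Q i * (Complex.normSq (x i b) / p b) := by
    rw [← Complex.ofReal_re (Q i * (Complex.normSq (x i b) / p b))]
    congr 1
    simp only [H, J, mul_diagonal, diagonal_mul]
    push_cast [Complex.normSq_eq_conj_mul_self]
    simp only [Complex.star_def]
    ring
  rw [e2, e3]

open scoped MatrixOrder in
theorem Matrix.PosSemidef.exists_eq_conjTranspose_mul_self {n : Type*} [Fintype n]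
    {M : Matrix n n ℂ} (hM : M.PosSemidef) : ∃ Z : Matrix n n ℂ, M = Zᴴ * Z := by
  classical
  exact CStarAlgebra.nonneg_iff_eq_star_mul_self.1 hM.nonneg

theorem IsCPTP.exists_kraus {A B : Type*} [Fintype A] [DecidableEq A] [Fintype B]
    {Γ : Matrix A A ℂ → Matrix B B ℂ} (hΓ : IsCPTP Γ) :
    ∃ (n : ℕ) (T : Fin n × B → Matrix B A ℂ), (∑ k, (T k)ᴴ * T k = 1) ∧
      ∀ M, Γ M = ∑ k, T k * M * (T k)ᴴ := by
  classical
  obtain ⟨hadd, hsmul, htr, hcp⟩ := hΓ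
  let L : Matrix A A ℂ →ₗ[ℂ] Matrix B B ℂ :=
    { toFun := Γ, map_add' := hadd, map_smul' := hsmul }
  let f := Fintype.equivFin A
  let v : Fin (Fintype.card A) × A → ℂ := fun x => if x.1 = f x.2 then 1 else 0
  obtain ⟨Z, hZ⟩ := (hcp _ _ (posSemidef_vecMulVec_self_star v)).exists_eq_conjTranspose_mul_self
  let T : Fin (Fintype.card A) × B → Matrix B A ℂ := fun k => of fun b a => star (Z k (f a, b))
  have hsingle : ∀ a a' b b', Γ (single a a' 1) b b' = ∑ k, T k b a * star (T k b' a') := by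
    intro a a' b b'
    have h := congrFun (congrFun hZ (f a, b)) (f a', b')
    have hM : (of fun c c' => vecMulVec v (star v) (f a, c) (f a', c')) = single a a' (1 : ℂ) := by
      ext c c'
      simp only [v, of_apply, vecMulVec_apply, single_apply, Pi.star_apply, f.apply_eq_iff_eq]
      by_cases h1 : a = c <;> by_cases h2 : a' = c' <;> simp [h1, h2]
    simp only [idTensor, of_apply, hM] at h
    rw [h]
    simp [T, Matrix.mul_apply]
  have hkraus : ∀ M, Γ M = ∑ k, T k * M * (T k)ᴴ := by
    intro M
    have hM : Γ M = ∑ a, ∑ a', M a a' • Γ (single a a' 1) := by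
      change L M = ∑ a, ∑ a', M a a' • L (single a a' 1)
      conv_lhs => rw [matrix_eq_sum_single M]
      simp only [map_sum, ← map_smul, smul_single, smul_eq_mul, mul_one]
    ext b b'
    rw [hM]
    simp only [Matrix.sum_apply, Matrix.smul_apply, hsingle, Matrix.mul_apply, smul_eq_mul,
      conjTranspose_apply, Finset.mul_sum, Finset.sum_mul]
    rw [Finset.sum_comm]
    simp_rw [Finset.sum_comm (s := (Finset.univ : Finset A))
      (t := (Finset.univ : Finset (Fin _ × B)))]
    refine Finset.sum_congr rfl fun k _ => Finset.sum_congr rfl fun a' _ =>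
      Finset.sum_congr rfl fun a _ => ?_
    ring
  refine ⟨_, T, ?_, hkraus⟩
  ext a' a
  have h := htr (single a a' 1)
  rw [hkraus, trace_sum] at h
  have e : ∀ k, (T k * single a a' (1 : ℂ) * (T k)ᴴ).trace = ((T k)ᴴ * T k) a' a := by
    intro k
    rw [Matrix.trace_mul_comm, ← Matrix.mul_assoc, Matrix.trace_mul_single]
    simp
  rw [Matrix.sum_apply, ← Finset.sum_congr rfl fun k _ => e k, h]
  by_cases haa : a = a'
  · subst haa
    simp
  · rw [Matrix.one_apply_ne (Ne.symm haa), Matrix.trace_single_eq_of_ne _ _ _ haa]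

theorem Matrix.IsHermitian.exists_unitary_diagonal {n : Type*} [Fintype n] [DecidableEq n]
    {M : Matrix n n ℂ} (h : M.IsHermitian) :
    ∃ U : Matrix n n ℂ, Uᴴ * U = 1 ∧ U * Uᴴ = 1 ∧
      Uᴴ * M * U = diagonal fun i => (h.eigenvalues i : ℂ) := by
  refine ⟨h.eigenvectorUnitary, ?_, ?_, ?_⟩
  · exact Unitary.coe_star_mul_self _
  · exact Unitary.coe_mul_star_self _
  · have := h.conjStarAlgAut_star_eigenvectorUnitary
    simpa [Unitary.conjStarAlgAut_apply, star_eq_conjTranspose, Function.comp_def] using this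

theorem linearMap_vecMulVec_star_eq_zero {A W : Type*} [Fintype A]
    [AddCommGroup W] [Module ℂ W] (L : Matrix A A ℂ →ₗ[ℂ] W)
    (hL : ∀ ρ, IsDensity ρ → L ρ = 0) (u v : A → ℂ) : L (vecMulVec u (star v)) = 0 := by
  have hself : ∀ v : A → ℂ, L (vecMulVec v (star v)) = 0 := by
    intro v
    by_cases hv : v = 0
    · simp [hv]
    have hpos := posSemidef_vecMulVec_self_star v
    have htr : (vecMulVec v (star v)).trace ≠ 0 := by
      rw [trace_vecMulVec]
      simpa using hv
    have hd : IsDensity ((vecMulVec v (star v)).trace⁻¹ • vecMulVec v (star v)) :=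
      ⟨hpos.smul (inv_nonneg.2 hpos.trace_nonneg), by
        rw [trace_smul, smul_eq_mul, inv_mul_cancel₀ htr]⟩
    have := hL _ hd
    rw [map_smul] at this
    exact (smul_eq_zero.1 this).resolve_left (inv_ne_zero htr)
  have h1 := hself (u + v)
  have h2 := hself (u + Complex.I • v)
  simp only [star_add, vecMulVec_add, add_vecMulVec, map_add, hself, star_smul, smul_vecMulVec,
    vecMulVec_smul, map_smul, zero_add, add_zero, smul_zero] at h1 h2
  have h3 : L (vecMulVec v (star u)) = L (vecMulVec u (star v)) := by
    have h4 : Complex.I • (L (vecMulVec v (star u)) - L (vecMulVec u (star v))) = 0 := by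
      rw [← h2]
      simp [sub_eq_add_neg]
    exact sub_eq_zero.1 ((smul_eq_zero.1 h4).resolve_left Complex.I_ne_zero)
  rw [h3, ← two_smul ℂ] at h1
  exact (smul_eq_zero.1 h1).resolve_left two_ne_zero

theorem sum_resolvent_le {R B E κ : Type*} [Fintype R] [DecidableEq R] [Fintype B] [DecidableEq B]
    [Fintype E] [DecidableEq E] [Fintype κ] (K : R → Matrix B E ℂ) (T : κ → Matrix B E ℂ)
    (p : B → ℝ) (q : E → ℝ) (hp : ∑ r, K r * (K r)ᴴ = diagonal fun b => (p b : ℂ))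
    (hq : ∑ r, (K r)ᵀ * (K r)ᵀᴴ = diagonal fun e => (q e : ℂ)) (hq0 : ∀ e, 0 ≤ q e)
    (hT : ∑ k, (T k)ᴴ * T k = 1)
    (hK : ∀ r r', ∑ k, T k * ((K r)ᵀ * (K r')ᵀᴴ) * (T k)ᴴ = K r * (K r')ᴴ)
    {t : ℝ} (ht : 0 < t) :
    ∑ r, ∑ b, ∑ e, Complex.normSq (K r b e) * (q e / (p b + t * q e)) ≤
      ∑ r, ∑ b, ∑ e, Complex.normSq (K r b e) * (p b / (q e + t * p b)) := by
  let S : κ → Matrix (R × B) (R × E) ℂ := fun k => (1 : Matrix R R ℂ) ⊗ₖ T k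
  have hS : ∑ k, (S k)ᴴ * S k = 1 := by
    have : ∀ k, (S k)ᴴ * S k = (1 : Matrix R R ℂ) ⊗ₖ ((T k)ᴴ * T k) := by
      intro k
      simp only [S, conjTranspose_kronecker, ← mul_kronecker_mul, conjTranspose_one, Matrix.one_mul]
    ext ⟨r, e⟩ ⟨r', e'⟩
    simp only [this, Matrix.sum_apply, kroneckerMap_apply, ← Finset.mul_sum]
    rw [← Matrix.sum_apply, hT, ← one_kronecker_one, kroneckerMap_apply]
  let Ψ : Matrix (R × E) B ℂ := of fun x b => K x.1 b x.2
  let Φ : Matrix (R × B) E ℂ := of fun x e => K x.1 x.2 e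
  have hΨ : Ψᴴ * Ψ = diagonal fun b => (p b : ℂ) := by
    have h := congrArg transpose hp
    rw [diagonal_transpose] at h
    rw [← h]
    ext b b'
    simp [Ψ, Matrix.mul_apply, Matrix.sum_apply, Fintype.sum_prod_type, mul_comm]
  have hΦ : Φᴴ * Φ = diagonal fun e => (q e : ℂ) := by
    have h := congrArg transpose hq
    rw [diagonal_transpose] at h
    rw [← h]
    ext e e'
    simp [Φ, Matrix.mul_apply, Matrix.sum_apply, Fintype.sum_prod_type, mul_comm]
  have hSapply : ∀ (M : Matrix (R × E) (R × E) ℂ) k r b r' b', (S k * M * (S k)ᴴ) (r, b) (r', b') =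
      (T k * (of fun e e' => M (r, e) (r', e')) * (T k)ᴴ) b b' := by
    intro M k r b r' b'
    simp [S, Matrix.mul_apply, Fintype.sum_prod_type, Matrix.one_apply, ite_mul, mul_ite,
      Finset.sum_ite_eq, apply_ite star]
  have hSΨ : ∑ k, S k * (Ψ * Ψᴴ) * (S k)ᴴ = Φ * Φᴴ := by
    ext ⟨r, b⟩ ⟨r', b'⟩
    rw [Matrix.sum_apply]
    simp only [hSapply]
    have h := congrFun (congrFun (hK r r') b) b'
    rw [Matrix.sum_apply] at h
    exact h
  have hTq : ∑ k, T k * (diagonal fun e => (q e : ℂ)) * (T k)ᴴ = diagonal fun b => (p b : ℂ) := by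
    rw [← hq, ← hp, ← Finset.sum_congr rfl fun r _ => hK r r, Finset.sum_comm]
    simp only [Matrix.mul_sum, Matrix.sum_mul]
  have hSσ : ∑ k, S k * (diagonal fun x : R × E => (q x.2 : ℂ)) * (S k)ᴴ =
      diagonal fun x : R × B => (p x.2 : ℂ) := by
    ext ⟨r, b⟩ ⟨r', b'⟩
    rw [Matrix.sum_apply]
    simp only [hSapply]
    by_cases hr : r = r'
    · subst hr
      have h := congrFun (congrFun hTq b) b'
      rw [Matrix.sum_apply] at h
      have e1 : (of fun e e' => (diagonal fun x : R × E => (q x.2 : ℂ)) (r, e) (r, e')) =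
          diagonal fun e => (q e : ℂ) := by
        ext e e'
        simp [diagonal_apply]
      rw [e1, h]
      simp [diagonal_apply]
    · have e1 : (of fun e e' => (diagonal fun x : R × E => (q x.2 : ℂ)) (r, e) (r', e')) = 0 := by
        ext e e'
        simp [hr]
      rw [e1]
      simp [hr]
  obtain ⟨Y, hY⟩ := exists_resolventFunctional_eq t Φ (fun x => p x.2) q hΦ
  have hσ : (diagonal fun x : R × E => (q x.2 : ℂ)).PosSemidef :=
    PosSemidef.diagonal fun x => by simpa using hq0 x.2
  have h1 := resolventFunctional_le_adjoint S hS ht.le (posSemidef_self_mul_conjTranspose Ψ) hσ Y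
  have h2 := resolventFunctional_le ht Ψ (fun x => q x.2) (fun x => hq0 x.2) p hΨ
    (∑ k, (S k)ᴴ * Y * S k)
  rw [hSΨ, hSσ, hY] at h1
  have h3 := h1.trans h2
  simp only [Fintype.sum_prod_type, Φ, Ψ, of_apply] at h3
  refine h3.trans_eq (Finset.sum_congr rfl fun r _ => Finset.sum_comm)

theorem sum_mul_log_le {R B E κ : Type*} [Fintype R] [DecidableEq R] [Fintype B] [DecidableEq B]
    [Fintype E] [DecidableEq E] [Fintype κ] (K : R → Matrix B E ℂ) (T : κ → Matrix B E ℂ)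
    (p : B → ℝ) (q : E → ℝ) (hp : ∑ r, K r * (K r)ᴴ = diagonal fun b => (p b : ℂ))
    (hq : ∑ r, (K r)ᵀ * (K r)ᵀᴴ = diagonal fun e => (q e : ℂ))
    (hT : ∑ k, (T k)ᴴ * T k = 1)
    (hK : ∀ r r', ∑ k, T k * ((K r)ᵀ * (K r')ᵀᴴ) * (T k)ᴴ = K r * (K r')ᴴ) :
    ∑ e, q e * Real.log (q e) ≤ ∑ b, p b * Real.log (p b) := by
  have hpb : ∀ b, p b = ∑ r, ∑ e, Complex.normSq (K r b e) := by
    intro b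
    have := congrFun (congrFun hp b) b
    simp only [Matrix.sum_apply, Matrix.mul_apply, conjTranspose_apply, diagonal_apply_eq,
      Complex.star_def, Complex.mul_conj] at this
    exact_mod_cast this.symm
  have hqe : ∀ e, q e = ∑ r, ∑ b, Complex.normSq (K r b e) := by
    intro e
    have := congrFun (congrFun hq e) e
    simp only [Matrix.sum_apply, Matrix.mul_apply, conjTranspose_apply, diagonal_apply_eq,
      transpose_apply, Complex.star_def, Complex.mul_conj] at this
    exact_mod_cast this.symm
  have hle_p : ∀ r b e, Complex.normSq (K r b e) ≤ p b := fun r b e => by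
    rw [hpb b, ← Fintype.sum_prod_type (fun x : R × E => Complex.normSq (K x.1 b x.2))]
    exact Finset.single_le_sum (f := fun x : R × E => Complex.normSq (K x.1 b x.2))
      (fun x _ => Complex.normSq_nonneg _) (Finset.mem_univ (r, e))
  have hle_q : ∀ r b e, Complex.normSq (K r b e) ≤ q e := fun r b e => by
    rw [hqe e, ← Fintype.sum_prod_type (fun x : R × B => Complex.normSq (K x.1 x.2 e))]
    exact Finset.single_le_sum (f := fun x : R × B => Complex.normSq (K x.1 x.2 e))
      (fun x _ => Complex.normSq_nonneg _) (Finset.mem_univ (r, b))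
  have hq0 : ∀ e, 0 ≤ q e := fun e => hqe e ▸
    Finset.sum_nonneg fun r _ => Finset.sum_nonneg fun b _ => Complex.normSq_nonneg _
  have hpq : ∀ r b e, Complex.normSq (K r b e) ≠ 0 → 0 < p b ∧ 0 < q e := fun r b e h =>
    have h0 := lt_of_le_of_ne (Complex.normSq_nonneg _) h.symm
    ⟨h0.trans_le (hle_p r b e), h0.trans_le (hle_q r b e)⟩
  have hlog := sum_mul_log_le_of_resolvent_le
    (fun x : R × B × E => Complex.normSq (K x.1 x.2.1 x.2.2))
    (fun x => p x.2.1 / q x.2.2) (fun x => q x.2.2 / p x.2.1)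
    (fun x hx => ⟨div_pos (hpq _ _ _ hx).1 (hpq _ _ _ hx).2,
      div_pos (hpq _ _ _ hx).2 (hpq _ _ _ hx).1⟩) fun t ht => by
    have h := sum_resolvent_le K T p q hp hq hq0 hT hK ht
    have hinv : ∀ (w x y : ℝ), (w ≠ 0 → 0 < x ∧ 0 < y) →
        w * (t + x / y)⁻¹ = w * (y / (x + t * y)) := by
      intro w x y hw
      by_cases h0 : w = 0
      · simp [h0]
      obtain ⟨hx, hy⟩ := hw h0
      congr 1
      field_simp
      ring
    simp only [Fintype.sum_prod_type]
    simpa only [fun r b e => hinv _ _ _ (hpq r b e),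
      fun r b e => hinv _ _ _ (fun hw => (hpq r b e hw).symm)] using h
  have hlog' : ∀ r b e, Complex.normSq (K r b e) * Real.log (q e / p b) =
      Complex.normSq (K r b e) * Real.log (q e) - Complex.normSq (K r b e) * Real.log (p b) := by
    intro r b e
    by_cases h0 : Complex.normSq (K r b e) = 0
    · simp [h0]
    rw [Real.log_div (hpq r b e h0).2.ne' (hpq r b e h0).1.ne', mul_sub]
  have hlog'' : ∀ r b e, Complex.normSq (K r b e) * Real.log (p b / q e) =
      Complex.normSq (K r b e) * Real.log (p b) - Complex.normSq (K r b e) * Real.log (q e) := by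
    intro r b e
    rw [← inv_div, Real.log_inv, mul_neg, hlog', neg_sub]
  have hP : ∑ r, ∑ b, ∑ e, Complex.normSq (K r b e) * Real.log (p b) =
      ∑ b, p b * Real.log (p b) := by
    rw [Finset.sum_comm]
    refine Finset.sum_congr rfl fun b _ => ?_
    simp only [← Finset.sum_mul, ← hpb]
  have hQ : ∑ r, ∑ b, ∑ e, Complex.normSq (K r b e) * Real.log (q e) =
      ∑ e, q e * Real.log (q e) := by
    rw [Finset.sum_congr rfl fun r _ => Finset.sum_comm, Finset.sum_comm]
    refine Finset.sum_congr rfl fun e _ => ?_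
    simp only [← Finset.sum_mul, ← hqe]
  simp only [Fintype.sum_prod_type, hlog', hlog'', Finset.sum_sub_distrib, hP, hQ] at hlog
  linarith

theorem vnEntropy_le_of_sum_mul_log_le {m n : Type*} [Fintype m] [DecidableEq m] [Fintype n]
    [DecidableEq n] {ρ : Matrix m m ℂ} {σ : Matrix n n ℂ} (hρ : ρ.IsHermitian)
    (hσ : σ.IsHermitian)
    (h : ∑ i, hσ.eigenvalues i * Real.log (hσ.eigenvalues i) ≤
      ∑ i, hρ.eigenvalues i * Real.log (hρ.eigenvalues i)) :
    vnEntropy ρ ≤ vnEntropy σ := by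
  rw [vnEntropy, vnEntropy, dif_pos hρ, dif_pos hσ]
  simp only [Real.logb, ← mul_div_assoc, ← Finset.sum_div]
  have := div_le_div_of_nonneg_right h (Real.log_pos one_lt_two).le
  linarith

theorem conj_mul_conj_conjTranspose {n : Type*} [Fintype n] [DecidableEq n] {U : Matrix n n ℂ}
    (h : U * Uᴴ = 1) : Uᴴᵀ * Uᴴᵀᴴ = 1 := by
  have hU : Uᴴᵀᴴ = Uᵀ := by
    ext i j
    simp
  rw [hU, ← transpose_mul, h, transpose_one]

theorem vnEntropy_le_of_degrading {R B E κ : Type*} [Fintype R] [DecidableEq R] [Fintype B]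
    [DecidableEq B] [Fintype E] [DecidableEq E] [Fintype κ] (K : R → Matrix B E ℂ)
    (T : κ → Matrix B E ℂ) (hT : ∑ k, (T k)ᴴ * T k = 1)
    (hK : ∀ r r', ∑ k, T k * ((K r)ᵀ * (K r')ᵀᴴ) * (T k)ᴴ = K r * (K r')ᴴ) :
    vnEntropy (∑ r, K r * (K r)ᴴ) ≤ vnEntropy (∑ r, (K r)ᵀ * (K r)ᵀᴴ) := by
  have hB : (∑ r, K r * (K r)ᴴ).IsHermitian := by
    simp [Matrix.IsHermitian, conjTranspose_sum]
  have hE : (∑ r, (K r)ᵀ * (K r)ᵀᴴ).IsHermitian := by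
    rw [Matrix.IsHermitian, conjTranspose_sum]
    exact Finset.sum_congr rfl fun r _ => by rw [conjTranspose_mul, conjTranspose_conjTranspose]
  refine vnEntropy_le_of_sum_mul_log_le hB hE ?_
  obtain ⟨U, hU, hU', hUp⟩ := hB.exists_unitary_diagonal
  obtain ⟨W, hW, hW', hWq⟩ := hE.exists_unitary_diagonal
  have hKK : ∀ r r', (Uᴴ * K r * Wᴴᵀ) * (Uᴴ * K r' * Wᴴᵀ)ᴴ = Uᴴ * (K r * (K r')ᴴ) * U := by
    intro r r'
    calc _ = Uᴴ * K r * (Wᴴᵀ * Wᴴᵀᴴ) * (K r')ᴴ * U := by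
          simp only [conjTranspose_mul, conjTranspose_conjTranspose, Matrix.mul_assoc]
      _ = _ := by
          rw [conj_mul_conj_conjTranspose hW', Matrix.mul_one]
          simp only [Matrix.mul_assoc]
  have hKKt : ∀ r r', (Uᴴ * K r * Wᴴᵀ)ᵀ * (Uᴴ * K r' * Wᴴᵀ)ᵀᴴ =
      Wᴴ * ((K r)ᵀ * (K r')ᵀᴴ) * W := by
    intro r r'
    calc _ = Wᴴ * (K r)ᵀ * (Uᴴᵀ * Uᴴᵀᴴ) * (K r')ᵀᴴ * W := by
          simp only [transpose_mul, transpose_transpose, conjTranspose_mul,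
            conjTranspose_conjTranspose, Matrix.mul_assoc]
      _ = _ := by
          rw [conj_mul_conj_conjTranspose hU', Matrix.mul_one]
          simp only [Matrix.mul_assoc]
  refine sum_mul_log_le (fun r => Uᴴ * K r * Wᴴᵀ) (fun k => Uᴴ * T k * W)
    hB.eigenvalues hE.eigenvalues ?_ ?_ ?_ ?_
  · simp only [hKK]
    rw [← hUp, Matrix.mul_sum, Matrix.sum_mul]
  · simp only [hKKt]
    rw [← hWq, Matrix.mul_sum, Matrix.sum_mul]
  · have h : ∀ k, (Uᴴ * T k * W)ᴴ * (Uᴴ * T k * W) = Wᴴ * ((T k)ᴴ * T k) * W := by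
      intro k
      calc _ = Wᴴ * (T k)ᴴ * (U * Uᴴ) * T k * W := by
            simp only [conjTranspose_mul, conjTranspose_conjTranspose, Matrix.mul_assoc]
        _ = _ := by
            rw [hU', Matrix.mul_one]
            simp only [Matrix.mul_assoc]
    simp only [h]
    rw [← Matrix.sum_mul, ← Matrix.mul_sum, hT, Matrix.mul_one, hW]
  · intro r r'
    have h : ∀ k, Uᴴ * T k * W * (Wᴴ * ((K r)ᵀ * (K r')ᵀᴴ) * W) * (Uᴴ * T k * W)ᴴ =
        Uᴴ * (T k * ((K r)ᵀ * (K r')ᵀᴴ) * (T k)ᴴ) * U := by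
      intro k
      calc _ = Uᴴ * T k * (W * Wᴴ) * ((K r)ᵀ * (K r')ᵀᴴ) * (W * Wᴴ) * (T k)ᴴ * U := by
            simp only [conjTranspose_mul, conjTranspose_conjTranspose, Matrix.mul_assoc]
        _ = _ := by
            rw [hW', Matrix.mul_one, Matrix.mul_one]
            simp only [Matrix.mul_assoc]
    simp only [hKK, hKKt, h]
    rw [← Matrix.sum_mul, ← Matrix.mul_sum, hK]

theorem stmt17 {A B E : Type*} [Fintype A] [DecidableEq A] [Fintype B] [DecidableEq B]
    [Fintype E] [DecidableEq E]
    (V : Matrix (B × E) A ℂ) (hV : Vᴴ * V = 1)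
    (Λ : Matrix A A ℂ → Matrix B B ℂ) (Λc : Matrix A A ℂ → Matrix E E ℂ)
    (hΛ : ∀ ρ, Λ ρ = ptrB (V * ρ * Vᴴ)) (hΛc : ∀ ρ, Λc ρ = ptrA (V * ρ * Vᴴ))
    (Γ : Matrix E E ℂ → Matrix B B ℂ) (hΓ : IsCPTP Γ)
    (hdeg : ∀ ρ, IsDensity ρ → Γ (Λc ρ) = Λ ρ) :
    ∀ ρ, IsDensity ρ → vnEntropy (Λ ρ) - vnEntropy (Λc ρ) ≤ 0 := by
  intro ρ hρ
  obtain ⟨Z, hZ⟩ := hρ.1.exists_eq_conjTranspose_mul_self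
  obtain ⟨n, T, hT, hΓT⟩ := hΓ.exists_kraus
  let K : A → Matrix B E ℂ := fun r => of fun b e => (V * Zᴴ) (b, e) r
  have hrank : ∀ r r', V * vecMulVec (fun a => Zᴴ a r) (star fun a => Zᴴ a r') * Vᴴ =
      of fun x y => K r x.1 x.2 * star (K r' y.1 y.2) := by
    intro r r'
    rw [mul_vecMulVec, vecMulVec_mul]
    ext x y
    simp [K, vecMulVec_apply, Matrix.mul_apply, mulVec, vecMul, dotProduct, mul_comm]
  have hB : ∀ r r', ptrB (of fun x y : B × E => K r x.1 x.2 * star (K r' y.1 y.2)) =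
      K r * (K r')ᴴ := by
    intro r r'
    ext b b'
    simp [ptrB, Matrix.mul_apply]
  have hE : ∀ r r', ptrA (of fun x y : B × E => K r x.1 x.2 * star (K r' y.1 y.2)) =
      (K r)ᵀ * (K r')ᵀᴴ := by
    intro r r'
    ext b b'
    simp [ptrA, Matrix.mul_apply]
  let L : Matrix A A ℂ →ₗ[ℂ] Matrix B B ℂ :=
    { toFun := fun M => Γ (ptrA (V * M * Vᴴ)) - ptrB (V * M * Vᴴ)
      map_add' := fun M N => by
        have hA : ∀ M N : Matrix (B × E) (B × E) ℂ, ptrA (M + N) = ptrA M + ptrA N :=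
          fun M N => by ext i j; simp [ptrA, Finset.sum_add_distrib]
        have hB : ∀ M N : Matrix (B × E) (B × E) ℂ, ptrB (M + N) = ptrB M + ptrB N :=
          fun M N => by ext i j; simp [ptrB, Finset.sum_add_distrib]
        rw [Matrix.mul_add, Matrix.add_mul, hA, hB, hΓ.1]
        abel
      map_smul' := fun c M => by
        have hA : ∀ M : Matrix (B × E) (B × E) ℂ, ptrA (c • M) = c • ptrA M :=
          fun M => by ext i j; simp [ptrA, Finset.mul_sum]
        have hB : ∀ M : Matrix (B × E) (B × E) ℂ, ptrB (c • M) = c • ptrB M :=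
          fun M => by ext i j; simp [ptrB, Finset.mul_sum]
        rw [Matrix.mul_smul, Matrix.smul_mul, hA, hB, hΓ.2.1, RingHom.id_apply, smul_sub] }
  have hL : ∀ σ, IsDensity σ → L σ = 0 := fun σ hσ => by
    have h := hdeg σ hσ
    rw [hΛ, hΛc] at h
    exact sub_eq_zero.2 h
  have hK : ∀ r r', ∑ k, T k * ((K r)ᵀ * (K r')ᵀᴴ) * (T k)ᴴ = K r * (K r')ᴴ := by
    intro r r'
    have h := sub_eq_zero.1 (linearMap_vecMulVec_star_eq_zero L hL
      (fun a => Zᴴ a r) (fun a => Zᴴ a r'))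
    rwa [hrank, hB, hE, hΓT] at h
  have hρV : V * ρ * Vᴴ = (V * Zᴴ) * (V * Zᴴ)ᴴ := by
    simp only [hZ, conjTranspose_mul, conjTranspose_conjTranspose, Matrix.mul_assoc]
  have hΛρ : Λ ρ = ∑ r, K r * (K r)ᴴ := by
    rw [hΛ, hρV]
    ext b b'
    simp only [ptrB, of_apply, Matrix.sum_apply, Matrix.mul_apply (M := V * Zᴴ),
      Matrix.mul_apply (M := K _), conjTranspose_apply, K]
    exact Finset.sum_comm
  have hΛcρ : Λc ρ = ∑ r, (K r)ᵀ * (K r)ᵀᴴ := by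
    rw [hΛc, hρV]
    ext e e'
    simp only [ptrA, of_apply, Matrix.sum_apply, Matrix.mul_apply (M := V * Zᴴ),
      Matrix.mul_apply (M := (K _)ᵀ), conjTranspose_apply, transpose_apply, K]
    exact Finset.sum_comm
  rw [hΛρ, hΛcρ, sub_nonpos]
  exact vnEntropy_le_of_degrading K T hT hK
end
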